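/- arXiv:2507.21901 — 5 statements merged into one kernel-verified Lean document; each statement's English description precedes it below -/
import Mathlib

section
/- Let N be an M×M symmetric matrix with aI ⪯ N ⪯ bI for constants 0 < a ≤ b, and let g, m ∈ ℝ^M with m ≠ 0. Then −⟨N^{-1/2} g, N^{-1/2} m⟩ / ‖N^{-1/2} m‖ ≤ −‖g‖/(3√b) + (8/(3√a))·‖g − m‖. -/
open scoped RealInnerProductSpace

/-- For an `M×M` symmetric matrix `N` (encoded as a self-adjoint continuous
linear map on Euclidean space) with `aI ⪯ N ⪯ bI`, `0 < a ≤ b`, and vectors `g, m` with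
`m ≠ 0`, one has `−⟨N^{-1/2} g, N^{-1/2} m⟩ / ‖N^{-1/2} m‖ ≤ −‖g‖/(3√b) + (8/(3√a))‖g − m‖`.
Here `S` is the (unique) symmetric positive semidefinite square root of `N` and
`Sinv = N^{-1/2}` is its inverse. -/
theorem normalized_inner_product_descent_bound
    (M : ℕ) (hM : 0 < M) (a b : ℝ) (ha : 0 < a) (hab : a ≤ b)
    (g m : EuclideanSpace ℝ (Fin M)) (hm : m ≠ 0)
    (N S Sinv : EuclideanSpace ℝ (Fin M) →L[ℝ] EuclideanSpace ℝ (Fin M))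
    (hNsymm : ∀ u v, ⟪N u, v⟫ = ⟪u, N v⟫)
    (hNa : ∀ u, a * ‖u‖ ^ 2 ≤ ⟪N u, u⟫)
    (hNb : ∀ u, ⟪N u, u⟫ ≤ b * ‖u‖ ^ 2)
    (hSsymm : ∀ u v, ⟪S u, v⟫ = ⟪u, S v⟫)
    (hSpos : ∀ u, 0 ≤ ⟪S u, u⟫)
    (hSS : S.comp S = N)
    (hSinv₁ : S.comp Sinv = ContinuousLinearMap.id ℝ (EuclideanSpace ℝ (Fin M)))
    (hSinv₂ : Sinv.comp S = ContinuousLinearMap.id ℝ (EuclideanSpace ℝ (Fin M))) :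
    -⟪Sinv g, Sinv m⟫ / ‖Sinv m‖ ≤
      -‖g‖ / (3 * Real.sqrt b) + (8 / (3 * Real.sqrt a)) * ‖g - m‖ := by
  have hb : 0 < b := ha.trans_le hab
  have hsa := Real.sqrt_pos.2 ha
  have hsb := Real.sqrt_pos.2 hb
  have hS : ∀ x, S (Sinv x) = x := fun x => DFunLike.congr_fun hSinv₁ x
  have hNS : ∀ u, ⟪N u, u⟫ = ‖S u‖ ^ 2 := fun u => by
    rw [← hSS, ContinuousLinearMap.comp_apply, hSsymm, real_inner_self_eq_norm_sq]
  have upper : ∀ x, ‖Sinv x‖ ≤ ‖x‖ / √a := fun x => by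
    have h := hNa (Sinv x)
    rw [hNS, hS] at h
    rw [le_div_iff₀ hsa]
    refine (sq_le_sq₀ (by positivity) (norm_nonneg x)).1 ?_
    rwa [mul_pow, Real.sq_sqrt ha.le, mul_comm]
  have lower : ∀ x, ‖x‖ / √b ≤ ‖Sinv x‖ := fun x => by
    have h := hNb (Sinv x)
    rw [hNS, hS] at h
    rw [div_le_iff₀ hsb]
    refine (sq_le_sq₀ (norm_nonneg x) (by positivity)).1 ?_
    rwa [mul_pow, Real.sq_sqrt hb.le, mul_comm]
  have hpos : 0 < ‖Sinv m‖ := (div_pos (norm_pos_iff.2 hm) hsb).trans_le (lower m)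
  have descent : -⟪Sinv g, Sinv m⟫ / ‖Sinv m‖ ≤ -‖Sinv m‖ + ‖Sinv (g - m)‖ := by
    rw [div_le_iff₀ hpos]
    have hsplit : ⟪Sinv g, Sinv m⟫ = ‖Sinv m‖ ^ 2 + ⟪Sinv (g - m), Sinv m⟫ := by
      rw [map_sub, inner_sub_left, real_inner_self_eq_norm_sq]
      ring
    have hcs := neg_le_of_abs_le (abs_real_inner_le_norm (Sinv (g - m)) (Sinv m))
    rw [hsplit]
    linarith
  have triangle : ‖g‖ / √b ≤ ‖g - m‖ / √b + ‖m‖ / √b := by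
    rw [← add_div]
    gcongr
    simpa using norm_add_le (g - m) m
  have compare : ‖g - m‖ / √b ≤ ‖g - m‖ / √a := by gcongr
  have hg : 0 ≤ ‖g‖ / √b := by positivity
  have hd : 0 ≤ ‖g - m‖ / √a := by positivity
  have hrhs : -‖g‖ / (3 * √b) + (8 / (3 * √a)) * ‖g - m‖ =
      -(‖g‖ / √b) / 3 + 8 / 3 * (‖g - m‖ / √a) := by
    field_simp
  rw [hrhs]
  linarith [upper (g - m), lower m]
end

section
/- Let f : ℝ^M → ℝ be L-smooth (differentiable with L-Lipschitz gradient), let N be an M×M symmetric matrix with aI ⪯ N ⪯ bI for constants 0 < a ≤ b, let m ∈ ℝ^M with m ≠ 0, let μ > 0, and set x' := x − μ N^{-1} m / ‖N^{-1/2} m‖. Then f(x') ≤ f(x) − (μ/(3√b))·‖∇f(x)‖ + (8μ/(3√a))·‖∇f(x) − m‖ + Lμ²/(2a). -/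
open scoped RealInnerProductSpace

/-- A function on a Hilbert space whose gradient is `L`-Lipschitz is bounded above by its quadratic
model. -/
theorem le_quadratic_model_of_lipschitz_gradient {E : Type*} [NormedAddCommGroup E]
    [InnerProductSpace ℝ E] [CompleteSpace E] {L : ℝ} {f : E → ℝ} {g : E → E}
    (hgrad : ∀ z, HasGradientAt f (g z) z)
    (hlip : ∀ z₁ z₂, ‖g z₁ - g z₂‖ ≤ L * ‖z₁ - z₂‖) (x d : E) :
    f (x + d) ≤ f x + ⟪g x, d⟫ + L / 2 * ‖d‖ ^ 2 := by
  let φ : ℝ → ℝ := fun t => f (x + t • d) - t * ⟪g x, d⟫ - L / 2 * ‖d‖ ^ 2 * t ^ 2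
  have hφ (t : ℝ) :
      HasDerivAt φ (⟪g (x + t • d), d⟫ - ⟪g x, d⟫ - L * ‖d‖ ^ 2 * t) t := by
    have hline : HasDerivAt (fun s : ℝ => x + s • d) d t := by
      simpa using ((hasDerivAt_id t).smul_const d).const_add x
    have hf : HasDerivAt (fun s : ℝ => f (x + s • d)) ⟪g (x + t • d), d⟫ t := by
      simpa [Function.comp_def] using (hgrad (x + t • d)).hasFDerivAt.comp_hasDerivAt t hline
    have h := (hf.sub ((hasDerivAt_id t).mul_const ⟪g x, d⟫)).sub
      ((hasDerivAt_pow 2 t).const_mul (L / 2 * ‖d‖ ^ 2))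
    refine h.congr_deriv ?_
    push_cast
    ring
  have hanti : AntitoneOn φ (Set.Icc 0 1) := by
    refine antitoneOn_of_deriv_nonpos (convex_Icc 0 1)
      (fun t _ => (hφ t).continuousAt.continuousWithinAt)
      (fun t _ => (hφ t).differentiableAt.differentiableWithinAt) fun t ht => ?_
    rw [interior_Icc] at ht
    have hg : ‖g (x + t • d) - g x‖ ≤ L * (t * ‖d‖) := by
      simpa [norm_smul, abs_of_pos ht.1] using hlip (x + t • d) x
    rw [(hφ t).deriv, ← inner_sub_left]
    nlinarith [real_inner_le_norm (g (x + t • d) - g x) d,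
      mul_le_mul_of_nonneg_right hg (norm_nonneg d)]
  have h := hanti (Set.left_mem_Icc.2 zero_le_one) (Set.right_mem_Icc.2 zero_le_one) zero_le_one
  simp only [φ, one_smul, zero_smul, add_zero] at h
  linarith

/-- Descent lemma for a normalized preconditioned step.  If `f` is `L`-smooth,
`N` is symmetric with `aI ⪯ N ⪯ bI` (`0 < a ≤ b`), `m ≠ 0`, `μ > 0`, and
`x' = x − μ N⁻¹ m / ‖N^{-1/2} m‖`, then
`f(x') ≤ f(x) − (μ/(3√b))‖∇f(x)‖ + (8μ/(3√a))‖∇f(x) − m‖ + Lμ²/(2a)`.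
Here `S` is the (unique) symmetric positive semidefinite square root of `N`, `Sinv = S⁻¹`,
so that `N⁻¹ = Sinv ∘ Sinv` and `N^{-1/2} = Sinv`. -/
theorem normalized_preconditioned_descent_lemma
    (M : ℕ) (hM : 0 < M) (L a b μ : ℝ) (hL : 0 < L) (ha : 0 < a) (hab : a ≤ b) (hμ : 0 < μ)
    (f : EuclideanSpace ℝ (Fin M) → ℝ)
    (gradf : EuclideanSpace ℝ (Fin M) → EuclideanSpace ℝ (Fin M))
    (hgrad : ∀ z, HasGradientAt f (gradf z) z)
    (hflip : ∀ z₁ z₂, ‖gradf z₁ - gradf z₂‖ ≤ L * ‖z₁ - z₂‖)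
    (m : EuclideanSpace ℝ (Fin M)) (hm : m ≠ 0)
    (N S Sinv : EuclideanSpace ℝ (Fin M) →L[ℝ] EuclideanSpace ℝ (Fin M))
    (hNsymm : ∀ u v, ⟪N u, v⟫ = ⟪u, N v⟫)
    (hNa : ∀ u, a * ‖u‖ ^ 2 ≤ ⟪N u, u⟫)
    (hNb : ∀ u, ⟪N u, u⟫ ≤ b * ‖u‖ ^ 2)
    (hSsymm : ∀ u v, ⟪S u, v⟫ = ⟪u, S v⟫)
    (hSpos : ∀ u, 0 ≤ ⟪S u, u⟫)
    (hSS : S.comp S = N)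
    (hSinv₁ : S.comp Sinv = ContinuousLinearMap.id ℝ (EuclideanSpace ℝ (Fin M)))
    (hSinv₂ : Sinv.comp S = ContinuousLinearMap.id ℝ (EuclideanSpace ℝ (Fin M)))
    (x x' : EuclideanSpace ℝ (Fin M))
    (hx' : x' = x - (μ / ‖Sinv m‖) • (Sinv (Sinv m))) :
    f x' ≤ f x - (μ / (3 * Real.sqrt b)) * ‖gradf x‖
      + (8 * μ / (3 * Real.sqrt a)) * ‖gradf x - m‖ + L * μ ^ 2 / (2 * a) := by
  have hSinv (u) : S (Sinv u) = u := by simpa using DFunLike.congr_fun hSinv₁ u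
  have hsymm (u v) : ⟪Sinv u, v⟫ = ⟪u, Sinv v⟫ := by
    simpa [hSinv] using (hSsymm (Sinv u) (Sinv v)).symm
  have hnorm (u) : ⟪N (Sinv u), Sinv u⟫ = ‖u‖ ^ 2 := by
    rw [← hSS, ContinuousLinearMap.comp_apply, hSsymm, hSinv, real_inner_self_eq_norm_sq]
  have hsa : 0 < √a := Real.sqrt_pos.2 ha
  have hsb : 0 < √b := Real.sqrt_pos.2 (ha.trans_le hab)
  have hupper (u) : ‖Sinv u‖ ≤ ‖u‖ / √a := by
    rw [le_div_iff₀ hsa]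
    refine le_of_sq_le_sq ?_ (norm_nonneg u)
    rw [mul_pow, Real.sq_sqrt ha.le, mul_comm, ← hnorm u]
    exact hNa _
  have hlower (u) : ‖u‖ / √b ≤ ‖Sinv u‖ := by
    rw [div_le_iff₀ hsb]
    refine le_of_sq_le_sq ?_ (by positivity)
    rw [mul_pow, Real.sq_sqrt (ha.trans_le hab).le, mul_comm, ← hnorm u]
    exact hNb _
  have hw : 0 < ‖Sinv m‖ := by
    refine norm_pos_iff.2 fun h => hm ?_
    rw [← hSinv m, h, map_zero]
  set w := Sinv m with hw_def
  set e := gradf x - m with he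
  have hg : Sinv (gradf x) = w + Sinv e := by rw [hw_def, he, map_sub]; abel
  have hdescent := le_quadratic_model_of_lipschitz_gradient hgrad hflip x (-((μ / ‖w‖) • Sinv w))
  rw [← sub_eq_add_neg, ← hx'] at hdescent
  have hstep : ‖-((μ / ‖w‖) • Sinv w)‖ ≤ μ / √a := by
    rw [norm_neg, norm_smul, Real.norm_of_nonneg (by positivity)]
    calc μ / ‖w‖ * ‖Sinv w‖ ≤ μ / ‖w‖ * (‖w‖ / √a) := by gcongr; exact hupper w
      _ = μ / √a := by field_simp
  have hquad : L / 2 * ‖-((μ / ‖w‖) • Sinv w)‖ ^ 2 ≤ L * μ ^ 2 / (2 * a) := by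
    calc _ ≤ L / 2 * (μ / √a) ^ 2 := by gcongr
      _ = L * μ ^ 2 / (2 * a) := by rw [div_pow, Real.sq_sqrt ha.le]; field_simp
  have hinner : ⟪gradf x, -((μ / ‖w‖) • Sinv w)⟫ ≤ -(μ * ‖w‖) + μ * (‖e‖ / √a) := by
    rw [inner_neg_right, inner_smul_right, ← hsymm, hg, inner_add_left,
      real_inner_self_eq_norm_sq]
    have h : -⟪Sinv e, w⟫ ≤ ‖e‖ / √a * ‖w‖ :=
      (neg_le_abs _).trans ((abs_real_inner_le_norm _ _).trans (by gcongr; exact hupper e))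
    calc -(μ / ‖w‖ * (‖w‖ ^ 2 + ⟪Sinv e, w⟫))
        = μ / ‖w‖ * (-‖w‖ ^ 2 + -⟪Sinv e, w⟫) := by ring
      _ ≤ μ / ‖w‖ * (-‖w‖ ^ 2 + ‖e‖ / √a * ‖w‖) := by gcongr
      _ = -(μ * ‖w‖) + μ * (‖e‖ / √a) := by field_simp
  have hgrad_le : ‖gradf x‖ / √b ≤ ‖w‖ + ‖e‖ / √a := by
    calc _ ≤ ‖w + Sinv e‖ := hg ▸ hlower (gradf x)
      _ ≤ ‖w‖ + ‖Sinv e‖ := norm_add_le _ _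
      _ ≤ _ := by gcongr; exact hupper e
  have hmul := mul_le_mul_of_nonneg_left hgrad_le hμ.le
  have hb : μ / (3 * √b) * ‖gradf x‖ = μ * (‖gradf x‖ / √b) / 3 := by field_simp
  have ha' : 8 * μ / (3 * √a) * ‖e‖ = 8 * (μ * (‖e‖ / √a)) / 3 := by field_simp
  have hw0 : 0 ≤ μ * ‖w‖ := by positivity
  have he0 : 0 ≤ μ * (‖e‖ / √a) := by positivity
  rw [hb, ha']
  linarith
end

section
/- Consider AdaHMM-type iterates over i = 0,…,T−1 (T ≥ 1) under the stated smoothness and PL assumptions, with stepsizes satisfying μ_x ≤ (√a/(6√b·κ))·μ_y. Let Δ₀ := P(x₀) − J(x₀,y₀). Then (1/T)·Σ_{i=0}^{T−1} dist(y_i, Y*(x_i)) ≤ 2·dist(y₀, Y*(x₀))/T + 6√b·Δ₀/(ν·μ_y·T) + (16√b/(√a·ν·T))·Σ_{i=0}^{T−1} ‖∇_y J(x_i,y_i) − m_{y,i}‖ + (3√b·κ·μ_y/a + μ_x/(2√a) + κ·μ_x/√a + 16√b·κ·μ_x/a + 2μ_y/√a). -/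
open scoped RealInnerProductSpace BigOperators

/-- The envelope function `P(x) = sup_y J(x,y)`. -/
noncomputable def Penv {α β : Type*} (J : α → β → ℝ) (x : α) : ℝ := ⨆ y, J x y

/-- The set of maximizers `Y*(x) = argmax_y J(x,y)`. -/
def argmaxY {α β : Type*} (J : α → β → ℝ) (x : α) : Set β := {y | ∀ y', J x y' ≤ J x y}

section Gradient

variable {E : Type*} [NormedAddCommGroup E] [InnerProductSpace ℝ E] [CompleteSpace E]

/-- Derivative of a function along a line, in terms of its gradient. -/
theorem HasGradientAt.hasDerivAt_line {f : E → ℝ} {g : E} {y s : E} {t : ℝ}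
    (h : HasGradientAt f g (y + t • s)) :
    HasDerivAt (fun τ : ℝ => f (y + τ • s)) ⟪g, s⟫ t := by
  have hline : HasDerivAt (fun τ : ℝ => y + τ • s) s t := by
    simpa using ((hasDerivAt_id t).smul_const s).const_add y
  exact (HasFDerivAt.comp_hasDerivAt t h.hasFDerivAt hline).congr_deriv (by simp)

/-- Mean value theorem along a segment, in terms of the gradient. -/
theorem exists_inner_gradient_eq_sub {f : E → ℝ} {g : E → E}
    (hg : ∀ z, HasGradientAt f (g z) z) (y s : E) :
    ∃ t ∈ Set.Ioo (0 : ℝ) 1, f (y + s) - f y = ⟪g (y + t • s), s⟫ := by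
  obtain ⟨t, ht, h⟩ := exists_hasDerivAt_eq_slope (fun τ : ℝ => f (y + τ • s))
    (fun τ => ⟪g (y + τ • s), s⟫) zero_lt_one
    (fun τ _ => (hg _).hasDerivAt_line.continuousAt.continuousWithinAt)
    (fun τ _ => (hg _).hasDerivAt_line)
  exact ⟨t, ht, by simpa using h.symm⟩

/-- A function with Lipschitz gradient lies above a concave quadratic model. -/
theorem le_of_lipschitz_gradient {f : E → ℝ} {g : E → E} {L : ℝ} (hL : 0 ≤ L)
    (hg : ∀ z, HasGradientAt f (g z) z) (hlip : ∀ u v, ‖g u - g v‖ ≤ L * ‖u - v‖) (y s : E) :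
    f y + ⟪g y, s⟫ - L * ‖s‖ ^ 2 ≤ f (y + s) := by
  obtain ⟨t, ht, h⟩ := exists_inner_gradient_eq_sub hg y s
  have h1 : ‖g y - g (y + t • s)‖ ≤ L * ‖s‖ := by
    refine (hlip _ _).trans (mul_le_mul_of_nonneg_left ?_ hL)
    rw [sub_add_cancel_left, norm_neg, norm_smul, Real.norm_of_nonneg ht.1.le]
    exact mul_le_of_le_one_left (norm_nonneg s) ht.2.le
  have h2 := real_inner_le_norm (g y - g (y + t • s)) s
  rw [inner_sub_left] at h2
  nlinarith [mul_le_mul_of_nonneg_right h1 (norm_nonneg s)]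

/-- A nonnegative function satisfying the PL inequality has a zero at distance controlled by
the square root of its value. -/
theorem exists_zero_of_pl [ProperSpace E] {f : E → ℝ} {g : E → E} {ν c : ℝ} (hν : 0 < ν)
    (hg : ∀ z, HasGradientAt f (g z) z) (hf : ∀ z, 0 ≤ f z)
    (hPL : ∀ z, 2 * ν * f z ≤ ‖g z‖ ^ 2) (hc : 0 < c) (hcν : 2 * c ^ 2 < ν) (y : E) :
    ∃ z, f z = 0 ∧ c * dist y z ≤ √(f y) := by
  have hcont : Continuous f := continuous_iff_continuousAt.2 fun z => (hg z).continuousAt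
  obtain ⟨z, hz⟩ := (show Continuous fun z => √(f z) + c * dist y z by
    fun_prop).exists_forall_le (by
      refine Filter.tendsto_atTop_mono (fun z => ?_)
        ((tendsto_dist_left_cocompact_atTop y).const_mul_atTop hc)
      linarith [Real.sqrt_nonneg (f z)])
  refine ⟨z, ?_, ?_⟩
  · by_contra h0
    have hpos : 0 < f z := lt_of_le_of_ne (hf z) (Ne.symm h0)
    have hgpos : 0 < ‖g z‖ := by
      have := hPL z
      have h1 : 0 < 2 * ν * f z := by positivity
      exact norm_pos_iff.2 fun h => by simp [h] at this; linarith
    have hd : HasDerivAt (fun τ : ℝ => √(f (z + τ • (-g z))) + c * (τ * ‖g z‖))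
        (⟪g z, -g z⟫ / (2 * √(f z)) + c * ‖g z‖) 0 := by
      have h1 : HasDerivAt (fun τ : ℝ => f (z + τ • (-g z))) ⟪g z, -g z⟫ 0 :=
        HasGradientAt.hasDerivAt_line (by simpa using hg z)
      have h2 := h1.sqrt (by simpa using h0)
      have h3 := ((hasDerivAt_id (0 : ℝ)).mul_const ‖g z‖).const_mul c
      exact (h2.add h3).congr_deriv (by simp)
    have hnonneg : 0 ≤ ⟪g z, -g z⟫ / (2 * √(f z)) + c * ‖g z‖ := by
      refine ge_of_tendsto (hd.tendsto_slope.mono_left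
        (nhdsWithin_mono (t := {(0 : ℝ)}ᶜ) (0 : ℝ)
          fun t (ht : t ∈ Set.Ioi (0 : ℝ)) => (ne_of_gt ht : t ≠ 0))) ?_
      filter_upwards [self_mem_nhdsWithin] with t ht
      have ht : 0 < t := ht
      have h1 := hz (z + t • (-g z))
      have h2 : dist y (z + t • (-g z)) ≤ dist y z + t * ‖g z‖ := by
        refine (dist_triangle y z _).trans_eq ?_
        rw [dist_self_add_right, norm_smul, norm_neg, Real.norm_of_nonneg ht.le]
      rw [slope_def_field]
      refine div_nonneg ?_ (by linarith)
      have h3 := mul_le_mul_of_nonneg_left h2 hc.le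
      simp only [zero_smul, add_zero, zero_mul, mul_zero]
      linarith
    have hs := Real.sqrt_pos.2 hpos
    rw [inner_neg_right, real_inner_self_eq_norm_sq, neg_div, neg_add_eq_sub, sub_nonneg,
      div_le_iff₀ (by positivity)] at hnonneg
    have h1 : ‖g z‖ ≤ 2 * c * √(f z) := by
      refine le_of_mul_le_mul_right ?_ hgpos
      linarith
    have h2 : ‖g z‖ ^ 2 ≤ 4 * c ^ 2 * f z := by
      have := pow_le_pow_left₀ hgpos.le h1 2
      rw [mul_pow, Real.sq_sqrt hpos.le] at this
      linarith
    nlinarith [hPL z]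
  · have := hz y
    simp only [dist_self, mul_zero, add_zero] at this
    linarith [Real.sqrt_nonneg (f z)]

/-- The PL inequality implies the error bound with the same constant. -/
theorem infDist_zero_le_of_pl [ProperSpace E] {f : E → ℝ} {g : E → E} {ν : ℝ} (hν : 0 < ν)
    (hg : ∀ z, HasGradientAt f (g z) z) (hf : ∀ z, 0 ≤ f z)
    (hPL : ∀ z, 2 * ν * f z ≤ ‖g z‖ ^ 2) (y : E) :
    ν * Metric.infDist y {z | f z = 0} ≤ ‖g y‖ := by
  set d := Metric.infDist y {z | f z = 0} with hd
  have hd0 : 0 ≤ d := Metric.infDist_nonneg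
  have hquad : ∀ q ∈ Set.Ioo 0 ν, q * d ^ 2 ≤ 2 * f y := by
    rintro q ⟨hq0, hqν⟩
    have hc : √(q / 2) ^ 2 = q / 2 := Real.sq_sqrt (by positivity)
    obtain ⟨z, hz0, hz⟩ := exists_zero_of_pl hν hg hf hPL (c := √(q / 2))
      (by positivity) (by linarith) y
    have hmem : z ∈ {z | f z = 0} := hz0
    have h1 : √(q / 2) * d ≤ √(f y) :=
      (mul_le_mul_of_nonneg_left (Metric.infDist_le_dist_of_mem hmem)
        (Real.sqrt_nonneg _)).trans hz
    have h2 := pow_le_pow_left₀ (by positivity) h1 2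
    rw [mul_pow, hc, Real.sq_sqrt (hf y)] at h2
    linarith
  have hlim : ν * d ^ 2 ≤ 2 * f y := by
    refine le_of_tendsto (f := fun q : ℝ => q * d ^ 2) (x := nhdsWithin ν (Set.Iio ν)) ?_ ?_
    · exact ((continuous_id.mul continuous_const).tendsto ν).mono_left nhdsWithin_le_nhds
    · filter_upwards [Ioo_mem_nhdsLT hν] with q hq using hquad q hq
  refine le_of_sq_le_sq ?_ (norm_nonneg _)
  nlinarith [hPL y]

end Gradient

section Preconditioner

variable {E : Type*} [NormedAddCommGroup E] [InnerProductSpace ℝ E]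
  {S Sinv N : E →L[ℝ] E} {a b : ℝ}

theorem norm_sq_apply_of_comp_self (hsymm : ∀ u v, ⟪S u, v⟫ = ⟪u, S v⟫) (hsq : S.comp S = N)
    (u : E) : ‖S u‖ ^ 2 = ⟪N u, u⟫ := by
  rw [← hsq, ContinuousLinearMap.comp_apply, hsymm, real_inner_self_eq_norm_sq]

theorem sqrt_mul_norm_inv_le (ha : 0 ≤ a) (hsymm : ∀ u v, ⟪S u, v⟫ = ⟪u, S v⟫)
    (hsq : S.comp S = N) (hinv : S.comp Sinv = ContinuousLinearMap.id ℝ E)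
    (hNa : ∀ u, a * ‖u‖ ^ 2 ≤ ⟪N u, u⟫) (w : E) : √a * ‖Sinv w‖ ≤ ‖w‖ := by
  have hw : S (Sinv w) = w := by simpa using congrArg (fun A => A w) hinv
  refine le_of_sq_le_sq ?_ (norm_nonneg _)
  have := hNa (Sinv w)
  rwa [← norm_sq_apply_of_comp_self hsymm hsq, hw, ← Real.sq_sqrt ha, ← mul_pow] at this

theorem norm_le_sqrt_mul_norm_inv (hb : 0 ≤ b) (hsymm : ∀ u v, ⟪S u, v⟫ = ⟪u, S v⟫)
    (hsq : S.comp S = N) (hinv : S.comp Sinv = ContinuousLinearMap.id ℝ E)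
    (hNb : ∀ u, ⟪N u, u⟫ ≤ b * ‖u‖ ^ 2) (w : E) : ‖w‖ ≤ √b * ‖Sinv w‖ := by
  have hw : S (Sinv w) = w := by simpa using congrArg (fun A => A w) hinv
  refine le_of_sq_le_sq ?_ (by positivity)
  have := hNb (Sinv w)
  rwa [← norm_sq_apply_of_comp_self hsymm hsq, hw, ← Real.sq_sqrt hb, ← mul_pow] at this

/-- A normalized preconditioned step of size `μ` has length at most `μ / √a`. -/
theorem norm_normalized_step_le {μ : ℝ} (hμ : 0 ≤ μ) (ha : 0 < a)
    (hsymm : ∀ u v, ⟪S u, v⟫ = ⟪u, S v⟫)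
    (hsq : S.comp S = N) (hinv : S.comp Sinv = ContinuousLinearMap.id ℝ E)
    (hNa : ∀ u, a * ‖u‖ ^ 2 ≤ ⟪N u, u⟫) (m : E) :
    ‖(μ / ‖Sinv m‖) • Sinv (Sinv m)‖ ≤ μ / √a := by
  have h := sqrt_mul_norm_inv_le ha.le hsymm hsq hinv hNa (Sinv m)
  have hsa := Real.sqrt_pos.2 ha
  rw [norm_smul, Real.norm_of_nonneg (by positivity)]
  rcases (norm_nonneg (Sinv m)).eq_or_lt with h0 | h0
  · rw [← h0]; simp; positivity
  · rw [le_div_iff₀ hsa, div_mul_eq_mul_div, div_mul_eq_mul_div, div_le_iff₀ h0]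
    nlinarith [mul_le_mul_of_nonneg_left h hμ]

/-- A normalized preconditioned step is an ascent direction, up to the momentum error. -/
theorem le_inner_normalized_step {μ : ℝ} (hμ : 0 ≤ μ) (ha : 0 < a) (hb : 0 < b)
    (hab : a ≤ b) (hsymm : ∀ u v, ⟪S u, v⟫ = ⟪u, S v⟫)
    (hsq : S.comp S = N) (hinv : S.comp Sinv = ContinuousLinearMap.id ℝ E)
    (hNa : ∀ u, a * ‖u‖ ^ 2 ≤ ⟪N u, u⟫) (hNb : ∀ u, ⟪N u, u⟫ ≤ b * ‖u‖ ^ 2)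
    {m : E} (hm : m ≠ 0) (g : E) :
    μ / √b * ‖g‖ - 2 * (μ / √a) * ‖g - m‖ ≤ ⟪g, (μ / ‖Sinv m‖) • Sinv (Sinv m)⟫ := by
  have hsa := Real.sqrt_pos.2 ha
  have hsb := Real.sqrt_pos.2 hb
  have hS : ∀ w, S (Sinv w) = w := fun w => by simpa using congrArg (fun A => A w) hinv
  have hv : 0 < ‖Sinv m‖ := norm_pos_iff.2 fun h => hm (by rw [← hS m, h, map_zero])
  have hmm : ⟪m, (μ / ‖Sinv m‖) • Sinv (Sinv m)⟫ = μ * ‖Sinv m‖ := by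
    have : ⟪m, Sinv (Sinv m)⟫ = ‖Sinv m‖ ^ 2 := by
      conv_lhs => rw [← hS m]
      rw [hsymm, hS, hS, real_inner_self_eq_norm_sq]
    rw [inner_smul_right, this]
    field_simp
  have hmb : μ / √b * ‖m‖ ≤ μ * ‖Sinv m‖ := by
    rw [div_mul_eq_mul_div, div_le_iff₀ hsb]
    nlinarith [mul_le_mul_of_nonneg_left
      (norm_le_sqrt_mul_norm_inv hb.le hsymm hsq hinv hNb m) hμ]
  have hgm : ⟪g, (μ / ‖Sinv m‖) • Sinv (Sinv m)⟫
      = μ * ‖Sinv m‖ + ⟪g - m, (μ / ‖Sinv m‖) • Sinv (Sinv m)⟫ := by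
    rw [inner_sub_left, hmm]; ring
  have herr := (abs_le.1 (abs_real_inner_le_norm (g - m) ((μ / ‖Sinv m‖) • Sinv (Sinv m)))).1
  have hstep := mul_le_mul_of_nonneg_left
    (norm_normalized_step_le hμ ha hsymm hsq hinv hNa m) (norm_nonneg (g - m))
  have hba : μ / √b ≤ μ / √a := div_le_div_of_nonneg_left hμ hsa (Real.sqrt_le_sqrt hab)
  have htri : μ / √b * ‖g‖ ≤ μ / √b * ‖m‖ + μ / √a * ‖g - m‖ := by
    have h1 : ‖g‖ ≤ ‖m‖ + ‖g - m‖ := by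
      simpa using norm_add_le m (g - m)
    have h2 := mul_le_mul_of_nonneg_left h1 (div_nonneg hμ hsb.le)
    have h3 := mul_le_mul_of_nonneg_right hba (norm_nonneg (g - m))
    linarith
  rw [hgm]
  linarith

end Preconditioner

section PartialGradient

variable {E F : Type*} [NormedAddCommGroup E] [InnerProductSpace ℝ E] [CompleteSpace E]
  [NormedAddCommGroup F] [InnerProductSpace ℝ F] [CompleteSpace F]
  {J : E → F → ℝ} {p : E} {q : F} {x : E} {y : F}

theorem HasGradientAt.partial_left
    (h : HasGradientAt (fun z : WithLp 2 (E × F) =>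
      J (WithLp.equiv 2 _ z).1 (WithLp.equiv 2 _ z).2)
      ((WithLp.equiv 2 _).symm (p, q)) ((WithLp.equiv 2 _).symm (x, y))) :
    HasGradientAt (fun u => J u y) p x := by
  have hemb : HasFDerivAt (fun u : E => (WithLp.toLp 2 (u, y) : WithLp 2 (E × F)))
      (((WithLp.prodContinuousLinearEquiv 2 ℝ E F).symm : E × F →L[ℝ] WithLp 2 (E × F)).comp
        (ContinuousLinearMap.inl ℝ E F)) x :=
    (WithLp.prodContinuousLinearEquiv 2 ℝ E F).symm.hasFDerivAt.comp x
      (hasFDerivAt_prodMk_left x y)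
  rw [hasGradientAt_iff_hasFDerivAt]
  refine (HasFDerivAt.comp x h.hasFDerivAt hemb).congr_fderiv ?_
  ext v
  simp [WithLp.prod_inner_apply]

theorem HasGradientAt.partial_right
    (h : HasGradientAt (fun z : WithLp 2 (E × F) =>
      J (WithLp.equiv 2 _ z).1 (WithLp.equiv 2 _ z).2)
      ((WithLp.equiv 2 _).symm (p, q)) ((WithLp.equiv 2 _).symm (x, y))) :
    HasGradientAt (J x) q y := by
  have hemb : HasFDerivAt (fun v : F => (WithLp.toLp 2 (x, v) : WithLp 2 (E × F)))
      (((WithLp.prodContinuousLinearEquiv 2 ℝ E F).symm : E × F →L[ℝ] WithLp 2 (E × F)).comp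
        (ContinuousLinearMap.inr ℝ E F)) y :=
    (WithLp.prodContinuousLinearEquiv 2 ℝ E F).symm.hasFDerivAt.comp y
      (hasFDerivAt_prodMk_right x y)
  rw [hasGradientAt_iff_hasFDerivAt]
  refine (HasFDerivAt.comp y h.hasFDerivAt hemb).congr_fderiv ?_
  ext v
  simp [WithLp.prod_inner_apply]

end PartialGradient

section Envelope

variable {α β : Type*} {J : α → β → ℝ}

theorem Penv_eq_of_mem_argmaxY {x : α} {z : β} (hz : z ∈ argmaxY J x) : Penv J x = J x z :=
  have : Nonempty β := ⟨z⟩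
  le_antisymm (ciSup_le hz) (le_ciSup (f := J x) ⟨J x z, Set.forall_mem_range.2 hz⟩ z)

theorem le_Penv {x : α} (h : (argmaxY J x).Nonempty) (y : β) : J x y ≤ Penv J x := by
  obtain ⟨z, hz⟩ := h
  exact Penv_eq_of_mem_argmaxY hz ▸ hz y

theorem argmaxY_eq_setOf_gap_eq_zero {x : α} (h : (argmaxY J x).Nonempty) :
    argmaxY J x = {z | Penv J x - J x z = 0} := by
  ext z
  refine ⟨fun hz => sub_eq_zero.2 (Penv_eq_of_mem_argmaxY hz), fun hz y => ?_⟩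
  exact (le_Penv h y).trans (sub_eq_zero.1 hz).le

variable {E F : Type*} [NormedAddCommGroup F] {J : E → F → ℝ}
  {gx : E → F → E} {gy : E → F → F} {L ν : ℝ}

/-- Under the PL inequality, the partial gradient bounds the distance to the maximizers. -/
theorem infDist_argmaxY_le [InnerProductSpace ℝ F] [CompleteSpace F] [ProperSpace F] (hν : 0 < ν)
    (hgy : ∀ x y, HasGradientAt (J x) (gy x y) y) (hne : ∀ x, (argmaxY J x).Nonempty)
    (hPL : ∀ x y, 2 * ν * (Penv J x - J x y) ≤ ‖gy x y‖ ^ 2) (x : E) (y : F) :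
    ν * Metric.infDist y (argmaxY J x) ≤ ‖gy x y‖ := by
  rw [argmaxY_eq_setOf_gap_eq_zero (hne x), ← norm_neg (gy x y)]
  refine infDist_zero_le_of_pl (f := fun z => Penv J x - J x z) (g := fun z => -gy x z) hν
    (fun z => ?_) (fun z => sub_nonneg.2 (le_Penv (hne x) z)) (by simpa using hPL x) y
  rw [hasGradientAt_iff_hasFDerivAt, map_neg]
  exact (hgy x z).hasFDerivAt.const_sub _

/-- The set of maximizers is Lipschitz in the parameter. -/
theorem infDist_argmaxY_le_add [NormedAddCommGroup E] [InnerProductSpace ℝ F]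
    [CompleteSpace F] [ProperSpace F] (hν : 0 < ν)
    (hgy : ∀ x y, HasGradientAt (J x) (gy x y) y) (hne : ∀ x, (argmaxY J x).Nonempty)
    (hPL : ∀ x y, 2 * ν * (Penv J x - J x y) ≤ ‖gy x y‖ ^ 2)
    (hlip : ∀ x₁ x₂ y, ‖gy x₁ y - gy x₂ y‖ ≤ L * ‖x₁ - x₂‖) (x x' : E) (y : F) :
    Metric.infDist y (argmaxY J x') ≤ Metric.infDist y (argmaxY J x) + L / ν * ‖x' - x‖ := by
  rw [← sub_le_iff_le_add, Metric.le_infDist (hne x)]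
  intro z hz
  have hcrit : gy x z = 0 := by
    have hmax : IsLocalMax (J x) z := Filter.Eventually.of_forall hz
    have := hmax.hasFDerivAt_eq_zero (hgy x z).hasFDerivAt
    simpa using this
  have h1 := infDist_argmaxY_le hν hgy hne hPL x' z
  have h2 := hlip x' x z
  rw [hcrit, sub_zero] at h2
  have h3 : Metric.infDist z (argmaxY J x') ≤ L / ν * ‖x' - x‖ := by
    rw [div_mul_eq_mul_div, le_div_iff₀ hν]
    linarith
  have h4 : Metric.infDist y (argmaxY J x') ≤ Metric.infDist z (argmaxY J x') + dist y z :=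
    Metric.infDist_le_infDist_add_dist
  linarith

/-- Change of the optimality gap when the parameter moves. -/
theorem gap_sub_gap_le [NormedAddCommGroup E] [InnerProductSpace ℝ E] [CompleteSpace E]
    (hL : 0 ≤ L) (hgx : ∀ x y, HasGradientAt (fun u => J u y) (gx x y) x)
    (hne : ∀ x, (argmaxY J x).Nonempty)
    (hlip : ∀ x y₁ y₂, ‖gx x y₁ - gx x y₂‖ ≤ L * ‖y₁ - y₂‖) (x s : E) (y : F) :
    (Penv J (x + s) - J (x + s) y) - (Penv J x - J x y) ≤
      L * ‖s‖ * Metric.infDist y (argmaxY J (x + s)) := by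
  have key : ∀ z ∈ argmaxY J (x + s),
      (Penv J (x + s) - J (x + s) y) - (Penv J x - J x y) ≤ L * ‖s‖ * dist y z := by
    intro z hz
    have hgrad : ∀ u, HasGradientAt (fun u => J u z - J u y) (gx u z - gx u y) u := fun u => by
      rw [hasGradientAt_iff_hasFDerivAt, map_sub]
      exact (hgx u z).hasFDerivAt.sub (hgx u y).hasFDerivAt
    obtain ⟨t, -, ht⟩ := exists_inner_gradient_eq_sub hgrad x s
    have h1 := real_inner_le_norm (gx (x + t • s) z - gx (x + t • s) y) s
    have h2 := mul_le_mul_of_nonneg_right (hlip (x + t • s) z y) (norm_nonneg s)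
    rw [Penv_eq_of_mem_argmaxY hz, dist_comm, dist_eq_norm]
    have h3 := le_Penv (hne x) z
    linarith
  rcases (mul_nonneg hL (norm_nonneg s)).eq_or_lt with h0 | h0
  · obtain ⟨z, hz⟩ := hne (x + s)
    have := key z hz
    rw [← h0, zero_mul] at this ⊢
    exact this
  · rw [mul_comm, ← div_le_iff₀ h0, Metric.le_infDist (hne _)]
    intro z hz
    rw [div_le_iff₀ h0, mul_comm]
    exact key z hz

end Envelope

/-- Averaged optimality-gap bound for AdaHMM-type iterates: under `L_f`
smoothness of `J`, the `ν`-PL condition with attained supremum, scaling matrices `N_{x,i}`,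
`N_{y,i}` with `aI ⪯ N ⪯ bI` (square roots `S`, inverses `Sinv`), nonzero momenta, normalized
preconditioned updates, and `μ_x ≤ (√a/(6√b κ)) μ_y` (`κ = L_f/ν`), the time-averaged distance
of `y_i` to `argmax J(x_i, ·)` satisfies the stated bound. -/
theorem adahmm_optimality_gap_bound
    (M₁ M₂ : ℕ) (hM₁ : 0 < M₁) (hM₂ : 0 < M₂)
    (Lf ν a b μx μy : ℝ) (hLf : 0 < Lf) (hν : 0 < ν) (ha : 0 < a) (hab : a ≤ b)
    (hμx : 0 < μx) (hμy : 0 < μy)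
    (J : EuclideanSpace ℝ (Fin M₁) → EuclideanSpace ℝ (Fin M₂) → ℝ)
    (gx : EuclideanSpace ℝ (Fin M₁) → EuclideanSpace ℝ (Fin M₂) → EuclideanSpace ℝ (Fin M₁))
    (gy : EuclideanSpace ℝ (Fin M₁) → EuclideanSpace ℝ (Fin M₂) → EuclideanSpace ℝ (Fin M₂))
    (hJdiff : ∀ x y,
      HasGradientAt
        (fun z : WithLp 2 (EuclideanSpace ℝ (Fin M₁) × EuclideanSpace ℝ (Fin M₂)) =>
          J (WithLp.equiv 2 _ z).1 (WithLp.equiv 2 _ z).2)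
        ((WithLp.equiv 2 _).symm (gx x y, gy x y)) ((WithLp.equiv 2 _).symm (x, y)))
    (hJlip : ∀ x₁ y₁ x₂ y₂,
      ‖gx x₁ y₁ - gx x₂ y₂‖ ^ 2 + ‖gy x₁ y₁ - gy x₂ y₂‖ ^ 2 ≤
        Lf ^ 2 * (‖x₁ - x₂‖ ^ 2 + ‖y₁ - y₂‖ ^ 2))
    (hattain : ∀ x, ∃ y, ∀ y', J x y' ≤ J x y)
    (hPL : ∀ x y, 2 * ν * (Penv J x - J x y) ≤ ‖gy x y‖ ^ 2)
    -- iterates, momenta and scaling matrices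
    (x : ℕ → EuclideanSpace ℝ (Fin M₁)) (y : ℕ → EuclideanSpace ℝ (Fin M₂))
    (mx : ℕ → EuclideanSpace ℝ (Fin M₁)) (my : ℕ → EuclideanSpace ℝ (Fin M₂))
    (hmx : ∀ i, mx i ≠ 0) (hmy : ∀ i, my i ≠ 0)
    (Nx Sx Sxinv : ℕ → EuclideanSpace ℝ (Fin M₁) →L[ℝ] EuclideanSpace ℝ (Fin M₁))
    (Ny Sy Syinv : ℕ → EuclideanSpace ℝ (Fin M₂) →L[ℝ] EuclideanSpace ℝ (Fin M₂))
    (hSxsymm : ∀ i u v, ⟪Sx i u, v⟫ = ⟪u, Sx i v⟫) (hSxpos : ∀ i u, 0 ≤ ⟪Sx i u, u⟫)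
    (hSxsq : ∀ i, (Sx i).comp (Sx i) = Nx i)
    (hSxinv₁ : ∀ i, (Sx i).comp (Sxinv i) = ContinuousLinearMap.id ℝ _)
    (hSxinv₂ : ∀ i, (Sxinv i).comp (Sx i) = ContinuousLinearMap.id ℝ _)
    (hNxa : ∀ i u, a * ‖u‖ ^ 2 ≤ ⟪Nx i u, u⟫) (hNxb : ∀ i u, ⟪Nx i u, u⟫ ≤ b * ‖u‖ ^ 2)
    (hSysymm : ∀ i u v, ⟪Sy i u, v⟫ = ⟪u, Sy i v⟫) (hSypos : ∀ i u, 0 ≤ ⟪Sy i u, u⟫)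
    (hSysq : ∀ i, (Sy i).comp (Sy i) = Ny i)
    (hSyinv₁ : ∀ i, (Sy i).comp (Syinv i) = ContinuousLinearMap.id ℝ _)
    (hSyinv₂ : ∀ i, (Syinv i).comp (Sy i) = ContinuousLinearMap.id ℝ _)
    (hNya : ∀ i u, a * ‖u‖ ^ 2 ≤ ⟪Ny i u, u⟫) (hNyb : ∀ i u, ⟪Ny i u, u⟫ ≤ b * ‖u‖ ^ 2)
    -- AdaHMM-type updates:  x_{i+1} = x_i − μ_x N⁻¹ m / ‖N^{-1/2} m‖, ascent in y
    (hxupd : ∀ i, x (i + 1) = x i - (μx / ‖Sxinv i (mx i)‖) • (Sxinv i (Sxinv i (mx i))))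
    (hyupd : ∀ i, y (i + 1) = y i + (μy / ‖Syinv i (my i)‖) • (Syinv i (Syinv i (my i))))
    -- two-time-scale stepsize condition μ_x ≤ (√a/(6√b·κ))·μ_y
    (hstep : μx ≤ (Real.sqrt a / (6 * Real.sqrt b * (Lf / ν))) * μy)
    (T : ℕ) (hT : 1 ≤ T) :
    (1 / (T : ℝ)) * ∑ i ∈ Finset.range T, Metric.infDist (y i) (argmaxY J (x i)) ≤
      2 * Metric.infDist (y 0) (argmaxY J (x 0)) / T
      + 6 * Real.sqrt b * (Penv J (x 0) - J (x 0) (y 0)) / (ν * μy * T)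
      + (16 * Real.sqrt b / (Real.sqrt a * ν * T)) *
          ∑ i ∈ Finset.range T, ‖gy (x i) (y i) - my i‖
      + (3 * Real.sqrt b * (Lf / ν) * μy / a + μx / (2 * Real.sqrt a)
          + (Lf / ν) * μx / Real.sqrt a + 16 * Real.sqrt b * (Lf / ν) * μx / a
          + 2 * μy / Real.sqrt a) := by
  have hb : 0 < b := ha.trans_le hab
  have hne : ∀ x, (argmaxY J x).Nonempty := hattain
  have hgx : ∀ x y, HasGradientAt (fun u => J u y) (gx x y) x :=
    fun x y => (hJdiff x y).partial_left
  have hgy : ∀ x y, HasGradientAt (J x) (gy x y) y := fun x y => (hJdiff x y).partial_right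
  have hlipx : ∀ x y₁ y₂, ‖gx x y₁ - gx x y₂‖ ≤ Lf * ‖y₁ - y₂‖ := fun x y₁ y₂ => by
    refine le_of_sq_le_sq ?_ (by positivity)
    have := hJlip x y₁ x y₂
    simp only [sub_self, norm_zero] at this
    nlinarith [sq_nonneg ‖gy x y₁ - gy x y₂‖]
  have hlipyx : ∀ x₁ x₂ y, ‖gy x₁ y - gy x₂ y‖ ≤ Lf * ‖x₁ - x₂‖ := fun x₁ x₂ y => by
    refine le_of_sq_le_sq ?_ (by positivity)
    have := hJlip x₁ y x₂ y
    simp only [sub_self, norm_zero] at this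
    nlinarith [sq_nonneg ‖gx x₁ y - gx x₂ y‖]
  have hlipyy : ∀ x y₁ y₂, ‖gy x y₁ - gy x y₂‖ ≤ Lf * ‖y₁ - y₂‖ := fun x y₁ y₂ => by
    refine le_of_sq_le_sq ?_ (by positivity)
    have := hJlip x y₁ x y₂
    simp only [sub_self, norm_zero] at this
    nlinarith [sq_nonneg ‖gx x y₁ - gx x y₂‖]
  obtain ⟨A, hA⟩ : ∃ A, A = √a := ⟨_, rfl⟩
  obtain ⟨B, hB⟩ : ∃ B, B = √b := ⟨_, rfl⟩
  have hA0 : 0 < A := hA ▸ Real.sqrt_pos.2 ha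
  have hB0 : 0 < B := hB ▸ Real.sqrt_pos.2 hb
  have haA : a = A ^ 2 := by rw [hA, Real.sq_sqrt ha.le]
  have hT0 : (0 : ℝ) < T := by exact_mod_cast hT
  have hratio : B * (Lf / ν) * μx ≤ A * μy / 6 := by
    rw [← hA, ← hB, div_mul_eq_mul_div, le_div_iff₀ (by positivity)] at hstep
    linarith
  have hsmall : Lf * (μx / A) ≤ ν * μy / (6 * B) := by
    rw [mul_div_assoc', div_le_div_iff₀ hA0 (by positivity)]
    have := mul_le_mul_of_nonneg_right hratio (show 0 ≤ 6 * ν by positivity)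
    field_simp at this
    linarith
  have hrec : ∀ i, 5 / 6 * (ν * μy / B) * Metric.infDist (y i) (argmaxY J (x i)) ≤
      (Penv J (x i) - J (x i) (y i)) - (Penv J (x (i + 1)) - J (x (i + 1)) (y (i + 1)))
      + 2 * (μy / A) * ‖gy (x i) (y i) - my i‖
      + Lf * ((μy / A) ^ 2 + μx / A * (μy / A + Lf / ν * (μx / A))) := by
    intro i
    have hd0 : 0 ≤ Metric.infDist (y i) (argmaxY J (x i)) := Metric.infDist_nonneg
    obtain ⟨sx, hsx⟩ : ∃ s, s = -((μx / ‖Sxinv i (mx i)‖) • Sxinv i (Sxinv i (mx i))) := ⟨_, rfl⟩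
    obtain ⟨sy, hsy⟩ : ∃ s, s = (μy / ‖Syinv i (my i)‖) • Syinv i (Syinv i (my i)) := ⟨_, rfl⟩
    have hx' : x (i + 1) = x i + sx := by rw [hxupd, hsx, sub_eq_add_neg]
    have hy' : y (i + 1) = y i + sy := by rw [hyupd, hsy]
    have hnx : ‖sx‖ ≤ μx / A := by
      rw [hsx, norm_neg, hA]
      exact norm_normalized_step_le hμx.le ha (hSxsymm i) (hSxsq i) (hSxinv₁ i) (hNxa i) _
    have hny : ‖sy‖ ≤ μy / A := by
      rw [hsy, hA]
      exact norm_normalized_step_le hμy.le ha (hSysymm i) (hSysq i) (hSyinv₁ i) (hNya i) _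
    have hasc : μy / B * ‖gy (x i) (y i)‖ - 2 * (μy / A) * ‖gy (x i) (y i) - my i‖ ≤
        ⟪gy (x i) (y i), sy⟫ := by
      rw [hsy, hA, hB]
      exact le_inner_normalized_step hμy.le ha hb hab (hSysymm i) (hSysq i) (hSyinv₁ i)
        (hNya i) (hNyb i) (hmy i) _
    have hmodel := le_of_lipschitz_gradient hLf.le (hgy (x i)) (hlipyy (x i)) (y i) sy
    have hEB := mul_le_mul_of_nonneg_left
      (infDist_argmaxY_le hν hgy hne hPL (x i) (y i)) (show 0 ≤ μy / B by positivity)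
    have hgap := gap_sub_gap_le hLf.le hgx hne hlipx (x i) sx (y i + sy)
    have hdist : Metric.infDist (y i + sy) (argmaxY J (x i + sx)) ≤
        Metric.infDist (y i) (argmaxY J (x i)) + μy / A + Lf / ν * (μx / A) := by
      have h1 := infDist_argmaxY_le_add hν hgy hne hPL hlipyx (x i) (x i + sx) (y i + sy)
      have h2 : Metric.infDist (y i + sy) (argmaxY J (x i)) ≤
          Metric.infDist (y i) (argmaxY J (x i)) + dist (y i + sy) (y i) :=
        Metric.infDist_le_infDist_add_dist
      rw [dist_self_add_left] at h2
      rw [add_sub_cancel_left] at h1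
      have h3 := mul_le_mul_of_nonneg_left hnx (show 0 ≤ Lf / ν by positivity)
      linarith
    have hgap' := mul_le_mul (mul_le_mul_of_nonneg_left hnx hLf.le) hdist
      Metric.infDist_nonneg (by positivity)
    have hsq := mul_le_mul_of_nonneg_left (pow_le_pow_left₀ (norm_nonneg sy) hny 2) hLf.le
    have habsorb := mul_le_mul_of_nonneg_right hsmall hd0
    have hcoef : ν * μy / (6 * B) = 1 / 6 * (ν * μy / B) := by field_simp
    have hcoef' : μy / B * (ν * Metric.infDist (y i) (argmaxY J (x i)))
        = ν * μy / B * Metric.infDist (y i) (argmaxY J (x i)) := by ring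
    rw [hcoef] at habsorb
    rw [hcoef'] at hEB
    rw [hx', hy']
    linarith
  have hsum := Finset.sum_le_sum fun i (_ : i ∈ Finset.range T) => hrec i
  rw [Finset.sum_add_distrib, Finset.sum_add_distrib, ← Finset.mul_sum, ← Finset.mul_sum,
    Finset.sum_range_sub' (fun i => Penv J (x i) - J (x i) (y i)), Finset.sum_const,
    Finset.card_range, nsmul_eq_mul] at hsum
  have hDT : 0 ≤ Penv J (x T) - J (x T) (y T) := sub_nonneg.2 (le_Penv (hne _) _)
  have hD0 : 0 ≤ Penv J (x 0) - J (x 0) (y 0) := sub_nonneg.2 (le_Penv (hne _) _)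
  have hd0 : 0 ≤ Metric.infDist (y 0) (argmaxY J (x 0)) := Metric.infDist_nonneg
  have hG0 : 0 ≤ ∑ i ∈ Finset.range T, ‖gy (x i) (y i) - my i‖ :=
    Finset.sum_nonneg fun i _ => norm_nonneg _
  rw [← hA, ← hB, haA]
  generalize ∑ i ∈ Finset.range T, Metric.infDist (y i) (argmaxY J (x i)) = dSum at *
  generalize ∑ i ∈ Finset.range T, ‖gy (x i) (y i) - my i‖ = eSum at *
  generalize Penv J (x 0) - J (x 0) (y 0) = D₀ at *
  generalize Metric.infDist (y 0) (argmaxY J (x 0)) = d₀ at *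
  have hmain : 1 / (T : ℝ) * dSum ≤ 6 / 5 * (B * D₀ / (ν * μy * T)
      + 2 * (B / (A * ν * T) * eSum) + B * (Lf / ν) * μy / A ^ 2 + B * (Lf / ν) * μx / A ^ 2
      + (Lf / ν) * μx / (A ^ 2 * μy) * (B * (Lf / ν) * μx)) := by
    have h1 : 5 / 6 * (ν * μy / B) * dSum ≤ D₀ + 2 * (μy / A) * eSum
        + T * (Lf * ((μy / A) ^ 2 + μx / A * (μy / A + Lf / ν * (μx / A)))) := by linarith
    have h2 := mul_le_mul_of_nonneg_left h1 (show 0 ≤ 6 / 5 * (B / (ν * μy * T)) by positivity)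
    refine (Eq.le ?_).trans (h2.trans_eq ?_)
    · field_simp
    · field_simp
      ring
  have hlast : (Lf / ν) * μx / (A ^ 2 * μy) * (B * (Lf / ν) * μx) ≤
      1 / 6 * ((Lf / ν) * μx / A) := by
    have := mul_le_mul_of_nonneg_left hratio
      (show 0 ≤ (Lf / ν) * μx / (A ^ 2 * μy) by positivity)
    refine this.trans_eq ?_
    field_simp
  have e1 : 6 * B * D₀ / (ν * μy * T) = 6 * (B * D₀ / (ν * μy * T)) := by ring
  have e2 : 16 * B / (A * ν * T) * eSum = 16 * (B / (A * ν * T) * eSum) := by ring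
  have e3 : 3 * B * (Lf / ν) * μy / A ^ 2 = 3 * (B * (Lf / ν) * μy / A ^ 2) := by ring
  have e4 : 16 * B * (Lf / ν) * μx / A ^ 2 = 16 * (B * (Lf / ν) * μx / A ^ 2) := by ring
  rw [e1, e2, e3, e4]
  have p1 : 0 ≤ B * D₀ / (ν * μy * T) := by positivity
  have p2 : 0 ≤ B / (A * ν * T) * eSum := by positivity
  have p3 : 0 ≤ B * (Lf / ν) * μy / A ^ 2 := by positivity
  have p4 : 0 ≤ B * (Lf / ν) * μx / A ^ 2 := by positivity
  have p5 : 0 ≤ (Lf / ν) * μx / A := by positivity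
  have p6 : 0 ≤ 2 * d₀ / T := by positivity
  have p7 : 0 ≤ μx / (2 * A) := by positivity
  have p8 : 0 ≤ 2 * μy / A := by positivity
  linarith
end

section
/- Consider decentralized diffusion iterates x_{k,i+1} = Σ_ℓ a_{kℓ}(x_{ℓ,i} − μ_x u^x_{ℓ,i}/‖u^x_{ℓ,i}‖), y_{k,i+1} = Σ_ℓ a_{kℓ}(y_{ℓ,i} + μ_y u^y_{ℓ,i}/‖u^y_{ℓ,i}‖) with A doubly stochastic, λ := ‖A − 𝟙𝟙ᵀ/K‖ < 1, μ_x ≤ μ_y, all u-vectors nonzero, and equal initialization (x_{1,0} = ⋯ = x_{K,0} and y_{1,0} = ⋯ = y_{K,0}). Then for every i ≥ 0: Ξ_{i+1} ≤ λ·Ξ_i + 4√K·λ·μ_y, hence Ξ_i ≤ 4√K·μ_y/(1−λ) for all i; and Ξ²_{i+1} ≤ λ·Ξ²_i + 8λ²·K·μ_y²/(1−λ), hence Ξ²_i ≤ 8K·μ_y²/(1−λ)² for all i. -/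
open scoped RealInnerProductSpace BigOperators

/-- The centroid `(1/K)·Σ_k v_k` of a family of vectors. -/
noncomputable def centroid {K : ℕ} {E : Type*} [AddCommMonoid E] [Module ℝ E]
    (v : Fin K → E) : E := (K : ℝ)⁻¹ • ∑ k, v k

/-- `‖V − W‖` for stacked (concatenated) vectors: `√(Σ_k ‖v_k − w_k‖²)`. -/
noncomputable def stackDist {K : ℕ} {E : Type*} [NormedAddCommGroup E]
    (v w : Fin K → E) : ℝ := Real.sqrt (∑ k, ‖v k - w k‖ ^ 2)

/-- Network disagreement norm `‖V − V_c‖` of a family of vectors. -/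
noncomputable def consensus {K : ℕ} {E : Type*} [NormedAddCommGroup E] [Module ℝ E]
    (v : Fin K → E) : ℝ := stackDist v (fun _ => centroid v)

/-- The stacked distance is the distance of the `ℓ²` product. -/
lemma stackDist_eq_norm_toLp {K : ℕ} {E : Type*} [NormedAddCommGroup E] (v w : Fin K → E) :
    stackDist v w = ‖(WithLp.toLp 2 (v - w) : PiLp 2 fun _ : Fin K => E)‖ := by
  simp [stackDist, PiLp.norm_eq_of_L2]

lemma consensus_nonneg {K : ℕ} {E : Type*} [NormedAddCommGroup E] [Module ℝ E]
    (v : Fin K → E) : 0 ≤ consensus v := Real.sqrt_nonneg _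

lemma stackDist_add_left_le {K : ℕ} {E : Type*} [NormedAddCommGroup E] {c : ℝ} (hc : 0 ≤ c)
    (v w g : Fin K → E) (hg : ∀ k, ‖g k‖ ≤ c) :
    stackDist (v + g) w ≤ stackDist v w + c * Real.sqrt K := by
  have hg' : ‖(WithLp.toLp 2 g : PiLp 2 fun _ : Fin K => E)‖ ≤ c * Real.sqrt K := by
    rw [PiLp.norm_eq_of_L2]
    apply Real.sqrt_le_iff.2 ⟨by positivity, ?_⟩
    calc ∑ k, ‖g k‖ ^ 2 ≤ ∑ _k : Fin K, c ^ 2 :=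
          Finset.sum_le_sum fun k _ => pow_le_pow_left₀ (norm_nonneg _) (hg k) 2
      _ = (c * Real.sqrt K) ^ 2 := by
          rw [mul_pow, Real.sq_sqrt (Nat.cast_nonneg K)]
          simp [mul_comm]
  rw [stackDist_eq_norm_toLp, stackDist_eq_norm_toLp,
    show v + g - w = (v - w) + g by abel, WithLp.toLp_add]
  exact (norm_add_le _ _).trans (by gcongr)

/-- A matrix acts on stacked vectors with at most its spectral norm. -/
lemma sum_norm_sq_matrix_smul_le {K M : ℕ} (B : Matrix (Fin K) (Fin K) ℝ)
    (v : Fin K → EuclideanSpace ℝ (Fin M)) :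
    ∑ k, ‖∑ l, B k l • v l‖ ^ 2 ≤
      ‖(Matrix.toEuclideanCLM (𝕜 := ℝ) (n := Fin K) B :
        EuclideanSpace ℝ (Fin K) →L[ℝ] EuclideanSpace ℝ (Fin K))‖ ^ 2 * ∑ k, ‖v k‖ ^ 2 := by
  simp only [EuclideanSpace.real_norm_sq_eq]
  rw [Finset.sum_comm, Finset.sum_comm (f := fun k j => (v k) j ^ 2), Finset.mul_sum]
  refine Finset.sum_le_sum fun j _ => ?_
  have h := pow_le_pow_left₀ (norm_nonneg _) ((Matrix.toEuclideanCLM (𝕜 := ℝ) (n := Fin K) B :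
    EuclideanSpace ℝ (Fin K) →L[ℝ] EuclideanSpace ℝ (Fin K)).le_opNorm
      (WithLp.toLp 2 fun l => v l j)) 2
  rw [mul_pow, EuclideanSpace.real_norm_sq_eq, EuclideanSpace.real_norm_sq_eq] at h
  simpa [Matrix.mulVec, dotProduct] using h

/-- Averaging with a doubly stochastic matrix contracts towards any common reference point. -/
lemma consensus_doublyStochastic_le {K M : ℕ} (hK : 0 < K) (A : Matrix (Fin K) (Fin K) ℝ)
    (hArow : ∀ k, ∑ l, A k l = 1) (hAcol : ∀ l, ∑ k, A k l = 1)
    (w : Fin K → EuclideanSpace ℝ (Fin M)) (c : EuclideanSpace ℝ (Fin M)) :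
    consensus (fun k => ∑ l, A k l • w l) ≤
      ‖(Matrix.toEuclideanCLM (𝕜 := ℝ) (n := Fin K)
        (A - (K : ℝ)⁻¹ • Matrix.of fun _ _ => (1 : ℝ)) :
      EuclideanSpace ℝ (Fin K) →L[ℝ] EuclideanSpace ℝ (Fin K))‖ *
        stackDist w (fun _ => c) := by
  have hK' : (K : ℝ) ≠ 0 := by positivity
  have hcent : centroid (fun k => ∑ l, A k l • w l) = (K : ℝ)⁻¹ • ∑ l, w l := by
    unfold centroid
    rw [Finset.sum_comm]
    simp only [← Finset.sum_smul, hAcol, one_smul]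
  have hdev : ∀ k, ∑ l, A k l • w l - (K : ℝ)⁻¹ • ∑ l, w l =
      ∑ l, (A - (K : ℝ)⁻¹ • Matrix.of fun _ _ => (1 : ℝ) :
        Matrix (Fin K) (Fin K) ℝ) k l • (w l - c) := by
    intro k
    have hB : ∑ l, (A - (K : ℝ)⁻¹ • Matrix.of fun _ _ => (1 : ℝ) :
        Matrix (Fin K) (Fin K) ℝ) k l = 0 := by
      simp [Finset.sum_sub_distrib, hArow, hK']
    simp_rw [smul_sub]
    rw [Finset.sum_sub_distrib, ← Finset.sum_smul, hB, zero_smul, sub_zero]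
    simp [sub_smul, Finset.sum_sub_distrib, Finset.smul_sum]
  unfold consensus stackDist
  apply Real.sqrt_le_iff.2 ⟨by positivity, ?_⟩
  rw [mul_pow, Real.sq_sqrt (by positivity), hcent]
  simp only [hdev]
  exact sum_norm_sq_matrix_smul_le _ _

lemma consensus_diffusion_step_le {K M : ℕ} (hK : 0 < K) (A : Matrix (Fin K) (Fin K) ℝ)
    (hArow : ∀ k, ∑ l, A k l = 1) (hAcol : ∀ l, ∑ k, A k l = 1) {c : ℝ} (hc : 0 ≤ c)
    (v g : Fin K → EuclideanSpace ℝ (Fin M)) (hg : ∀ k, ‖g k‖ ≤ c) :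
    consensus (fun k => ∑ l, A k l • (v l + g l)) ≤
      ‖(Matrix.toEuclideanCLM (𝕜 := ℝ) (n := Fin K)
        (A - (K : ℝ)⁻¹ • Matrix.of fun _ _ => (1 : ℝ)) :
      EuclideanSpace ℝ (Fin K) →L[ℝ] EuclideanSpace ℝ (Fin K))‖ *
        (consensus v + c * Real.sqrt K) := by
  refine (consensus_doublyStochastic_le hK A hArow hAcol (v + g) (centroid v)).trans ?_
  gcongr
  exact stackDist_add_left_le hc _ _ _ hg

lemma consensus_eq_zero_of_const {K : ℕ} (hK : 0 < K) {E : Type*} [NormedAddCommGroup E]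
    [Module ℝ E] (v : Fin K → E) (hv : ∀ k k', v k = v k') : consensus v = 0 := by
  have hK' : (K : ℝ) ≠ 0 := by positivity
  obtain ⟨c, rfl⟩ : ∃ c, v = fun _ => c := ⟨v ⟨0, hK⟩, funext fun k => hv _ _⟩
  have : centroid (fun _ : Fin K => c) = c := by
    simp only [centroid, Finset.sum_const, Finset.card_univ, Fintype.card_fin]
    rw [← Nat.cast_smul_eq_nsmul ℝ, smul_smul, inv_mul_cancel₀ hK', one_smul]
  simp [consensus, stackDist, this]

lemma norm_div_norm_smul {E : Type*} [NormedAddCommGroup E] [NormedSpace ℝ E] {c : ℝ}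
    (hc : 0 ≤ c) {u : E} (hu : u ≠ 0) : ‖(c / ‖u‖) • u‖ = c := by
  rw [norm_smul, Real.norm_of_nonneg (by positivity), div_mul_cancel₀ _ (norm_ne_zero_iff.2 hu)]

/-- Convexity of the square, with weights `lam` and `1 - lam`. -/
lemma sq_mul_add_le {lam : ℝ} (h0 : 0 ≤ lam) (h1 : lam < 1) (a s : ℝ) :
    (lam * (a + s)) ^ 2 ≤ lam * a ^ 2 + lam ^ 2 * s ^ 2 / (1 - lam) := by
  have h : 0 < 1 - lam := sub_pos.2 h1
  have key : lam * a ^ 2 + lam ^ 2 * s ^ 2 / (1 - lam) - (lam * (a + s)) ^ 2 =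
      lam * ((1 - lam) * a - lam * s) ^ 2 / (1 - lam) := by
    field_simp
    ring
  have : 0 ≤ lam * ((1 - lam) * a - lam * s) ^ 2 / (1 - lam) := by positivity
  linarith

/-- A sequence starting at zero stays below any supersolution of its affine recursion. -/
lemma le_of_affine_recursion {lam b C : ℝ} (h0 : 0 ≤ lam) (hC : 0 ≤ C) (hb : lam * C + b ≤ C)
    (s : ℕ → ℝ) (hs0 : s 0 = 0) (hs : ∀ i, s (i + 1) ≤ lam * s i + b) (i : ℕ) : s i ≤ C := by
  induction i with
  | zero => rwa [hs0]
  | succ i ih => nlinarith [hs i, mul_le_mul_of_nonneg_left ih h0]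

/-- Network consensus bounds for decentralized normalized diffusion iterates:
with `λ = ‖A − 𝟙𝟙ᵀ/K‖ < 1`, `μ_x ≤ μ_y` and equal initialization,
`Ξ_{i+1} ≤ λΞ_i + 4√K λ μ_y`, hence `Ξ_i ≤ 4√K μ_y/(1−λ)`, and
`Ξ²_{i+1} ≤ λΞ²_i + 8λ²K μ_y²/(1−λ)`, hence `Ξ²_i ≤ 8K μ_y²/(1−λ)²`. -/
theorem decentralized_consensus_bounds
    (M₁ M₂ K : ℕ) (hM₁ : 0 < M₁) (hM₂ : 0 < M₂) (hK : 0 < K)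
    (μx μy lam : ℝ) (hμx : 0 < μx) (hμy : 0 < μy) (hμxy : μx ≤ μy)
    (A : Matrix (Fin K) (Fin K) ℝ) (hApos : ∀ k l, 0 ≤ A k l)
    (hArow : ∀ k, ∑ l, A k l = 1) (hAcol : ∀ l, ∑ k, A k l = 1)
    (hlam : lam = ‖(Matrix.toEuclideanCLM (𝕜 := ℝ) (n := Fin K)
        (A - (K : ℝ)⁻¹ • Matrix.of fun _ _ => (1 : ℝ)) :
      EuclideanSpace ℝ (Fin K) →L[ℝ] EuclideanSpace ℝ (Fin K))‖)
    (hlam1 : lam < 1)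
    (x : Fin K → ℕ → EuclideanSpace ℝ (Fin M₁)) (y : Fin K → ℕ → EuclideanSpace ℝ (Fin M₂))
    (ux : Fin K → ℕ → EuclideanSpace ℝ (Fin M₁)) (uy : Fin K → ℕ → EuclideanSpace ℝ (Fin M₂))
    (hux : ∀ k i, ux k i ≠ 0) (huy : ∀ k i, uy k i ≠ 0)
    (hxupd : ∀ k i, x k (i + 1) = ∑ l, A k l • (x l i - (μx / ‖ux l i‖) • ux l i))
    (hyupd : ∀ k i, y k (i + 1) = ∑ l, A k l • (y l i + (μy / ‖uy l i‖) • uy l i))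
    -- equal initialization
    (hx0 : ∀ k k', x k 0 = x k' 0) (hy0 : ∀ k k', y k 0 = y k' 0) :
    (∀ i : ℕ,
      consensus (fun k => x k (i + 1)) + consensus (fun k => y k (i + 1)) ≤
        lam * (consensus (fun k => x k i) + consensus (fun k => y k i))
        + 4 * Real.sqrt K * lam * μy) ∧
    (∀ i : ℕ,
      consensus (fun k => x k i) + consensus (fun k => y k i) ≤
        4 * Real.sqrt K * μy / (1 - lam)) ∧
    (∀ i : ℕ,
      consensus (fun k => x k (i + 1)) ^ 2 + consensus (fun k => y k (i + 1)) ^ 2 ≤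
        lam * (consensus (fun k => x k i) ^ 2 + consensus (fun k => y k i) ^ 2)
        + 8 * lam ^ 2 * K * μy ^ 2 / (1 - lam)) ∧
    (∀ i : ℕ,
      consensus (fun k => x k i) ^ 2 + consensus (fun k => y k i) ^ 2 ≤
        8 * K * μy ^ 2 / (1 - lam) ^ 2) := by
  have hlam0 : 0 ≤ lam := hlam ▸ norm_nonneg _
  have h1 : 0 < 1 - lam := sub_pos.2 hlam1
  have hx : ∀ i, consensus (fun k => x k (i + 1)) ≤
      lam * (consensus (fun k => x k i) + μy * Real.sqrt K) := by
    intro i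
    simp only [hxupd, sub_eq_add_neg (x _ i)]
    rw [hlam]
    refine consensus_diffusion_step_le hK A hArow hAcol hμy.le _ _ fun k => ?_
    rw [norm_neg, norm_div_norm_smul hμx.le (hux k i)]
    exact hμxy
  have hy : ∀ i, consensus (fun k => y k (i + 1)) ≤
      lam * (consensus (fun k => y k i) + μy * Real.sqrt K) := by
    intro i
    simp only [hyupd]
    rw [hlam]
    exact consensus_diffusion_step_le hK A hArow hAcol hμy.le _ _ fun k =>
      (norm_div_norm_smul hμy.le (huy k i)).le
  have hx0' := consensus_eq_zero_of_const hK (fun k => x k 0) hx0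
  have hy0' := consensus_eq_zero_of_const hK (fun k => y k 0) hy0
  have hsum : ∀ i : ℕ,
      consensus (fun k => x k (i + 1)) + consensus (fun k => y k (i + 1)) ≤
        lam * (consensus (fun k => x k i) + consensus (fun k => y k i))
        + 4 * Real.sqrt K * lam * μy := by
    intro i
    have : 0 ≤ Real.sqrt K * lam * μy := by positivity
    linarith [hx i, hy i]
  have hsq : ∀ i : ℕ,
      consensus (fun k => x k (i + 1)) ^ 2 + consensus (fun k => y k (i + 1)) ^ 2 ≤
        lam * (consensus (fun k => x k i) ^ 2 + consensus (fun k => y k i) ^ 2)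
        + 8 * lam ^ 2 * K * μy ^ 2 / (1 - lam) := by
    intro i
    have hx2 := (pow_le_pow_left₀ (consensus_nonneg _) (hx i) 2).trans
      (sq_mul_add_le hlam0 hlam1 _ _)
    have hy2 := (pow_le_pow_left₀ (consensus_nonneg _) (hy i) 2).trans
      (sq_mul_add_le hlam0 hlam1 _ _)
    rw [mul_pow μy, Real.sq_sqrt (Nat.cast_nonneg K)] at hx2 hy2
    have hpos : 0 ≤ lam ^ 2 * (μy ^ 2 * K) / (1 - lam) := by positivity
    have heq : 8 * lam ^ 2 * K * μy ^ 2 / (1 - lam) =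
        8 * (lam ^ 2 * (μy ^ 2 * K) / (1 - lam)) := by ring
    rw [heq]
    linarith
  refine ⟨hsum, ?_, hsq, ?_⟩
  · refine le_of_affine_recursion hlam0 (by positivity) ?_ _ (by simp [hx0', hy0']) hsum
    have key : 4 * Real.sqrt K * μy / (1 - lam) -
        (lam * (4 * Real.sqrt K * μy / (1 - lam)) + 4 * Real.sqrt K * lam * μy) =
        4 * Real.sqrt K * μy * (1 - lam) := by
      field_simp
      ring
    have : 0 ≤ 4 * Real.sqrt K * μy * (1 - lam) := by positivity
    linarith
  · refine le_of_affine_recursion hlam0 (by positivity) ?_ _ (by simp [hx0', hy0']) hsq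
    have key : 8 * K * μy ^ 2 / (1 - lam) ^ 2 -
        (lam * (8 * K * μy ^ 2 / (1 - lam) ^ 2) + 8 * lam ^ 2 * K * μy ^ 2 / (1 - lam)) =
        8 * K * μy ^ 2 * (1 + lam) := by
      field_simp
      ring
    have : 0 ≤ 8 * K * μy ^ 2 * (1 + lam) := by positivity
    linarith
end

section
/- Fix ε with 0 < ε ≤ 1 and define P : ℝ → ℝ by P(x) = 2.5 − 2εx for x < −1/ε; P(x) = 4 − (ε/2)x for −1/ε ≤ x < 0; P(x) = (x−2)² for x ≥ 0. Then: (i) P is continuous on ℝ; (ii) P is differentiable at every x ∈ (−1/ε, 0) with P′(x) = −ε/2, so |P′(x)| ≤ ε there (every such point is ε-stationary); (iii) P attains its global minimum 0 uniquely at x = 2; (iv) P(x) > 4 for every x ∈ (−1/ε, 0), and every x ∈ (−1/ε, 0) satisfies |x − 2| > 2; hence the ε-stationary points in (−1/ε, 0) are all at distance greater than 2 from the global minimizer. -/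
/-- For `0 < ε ≤ 1`, the piecewise function
`P(x) = 2.5 − 2εx` on `(−∞, −1/ε)`, `P(x) = 4 − (ε/2)x` on `[−1/ε, 0)`, `P(x) = (x−2)²` on
`[0, ∞)` is (i) continuous, (ii) differentiable on `(−1/ε, 0)` with derivative `−ε/2`, so every
point there is `ε`-stationary, (iii) attains its global minimum `0` uniquely at `x = 2`, and
(iv) satisfies `P(x) > 4` and `|x − 2| > 2` for every `x ∈ (−1/ε, 0)`: all these `ε`-stationary
points lie at distance greater than `2` from the global minimizer. -/
theorem piecewise_nonsmooth_stationarity_gap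
    (ε : ℝ) (hε0 : 0 < ε) (hε1 : ε ≤ 1)
    (P : ℝ → ℝ)
    (h1 : ∀ x : ℝ, x < -(1 / ε) → P x = 2.5 - 2 * ε * x)
    (h2 : ∀ x : ℝ, -(1 / ε) ≤ x → x < 0 → P x = 4 - (ε / 2) * x)
    (h3 : ∀ x : ℝ, 0 ≤ x → P x = (x - 2) ^ 2) :
    Continuous P ∧
    (∀ x ∈ Set.Ioo (-(1 / ε)) (0 : ℝ), HasDerivAt P (-(ε / 2)) x ∧ |(-(ε / 2) : ℝ)| ≤ ε) ∧
    (P 2 = 0 ∧ (∀ x : ℝ, 0 ≤ P x) ∧ (∀ x : ℝ, P x = 0 → x = 2)) ∧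
    (∀ x ∈ Set.Ioo (-(1 / ε)) (0 : ℝ), 4 < P x ∧ 2 < |x - 2|) := by
  have hb : -(1 / ε) < 0 := by simpa using hε0
  have hbε : ε * -(1 / ε) = -1 := by field_simp
  refine ⟨?_, ?_, ⟨?_, ?_, ?_⟩, ?_⟩
  · have hP : P = fun x => if x ≤ -(1 / ε) then 2.5 - 2 * ε * x
        else if x ≤ 0 then 4 - (ε / 2) * x else (x - 2) ^ 2 := by
      funext x
      split_ifs with hx hx0
      · rcases hx.lt_or_eq with hlt | rfl
        · exact h1 x hlt
        · rw [h2 _ le_rfl hb]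
          linarith
      · rcases hx0.lt_or_eq with hlt | rfl
        · exact h2 x (not_le.mp hx).le hlt
        · rw [h3 0 le_rfl]
          norm_num
      · exact h3 x (not_le.mp hx0).le
    rw [hP]
    refine Continuous.if_le (by fun_prop)
      (Continuous.if_le (by fun_prop) (by fun_prop) continuous_id continuous_const ?_)
      continuous_id continuous_const ?_
    · rintro x rfl
      norm_num
    · rintro x rfl
      rw [if_pos hb.le]
      linarith
  · rintro x ⟨hxl, hxr⟩
    constructor
    · have hlin : HasDerivAt (fun y : ℝ => 4 - (ε / 2) * y) (-(ε / 2)) x := by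
        simpa using ((hasDerivAt_id x).const_mul (ε / 2)).const_sub 4
      refine hlin.congr_of_eventuallyEq ?_
      filter_upwards [Ioo_mem_nhds hxl hxr] with y hy
      exact h2 y hy.1.le hy.2
    · rw [abs_neg, abs_of_pos (half_pos hε0)]
      exact half_le_self hε0.le
  · rw [h3 2 zero_le_two, sub_self, zero_pow two_ne_zero]
  · intro x
    rcases lt_or_ge x 0 with hx | hx
    · have hεx := mul_neg_of_pos_of_neg hε0 hx
      rcases lt_or_ge x (-(1 / ε)) with hxb | hxb
      · rw [h1 x hxb]
        linarith
      · rw [h2 x hxb hx]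
        linarith
    · rw [h3 x hx]
      positivity
  · intro x hPx
    rcases lt_or_ge x 0 with hx | hx
    · have hεx := mul_neg_of_pos_of_neg hε0 hx
      rcases lt_or_ge x (-(1 / ε)) with hxb | hxb
      · rw [h1 x hxb] at hPx
        linarith
      · rw [h2 x hxb hx] at hPx
        linarith
    · rw [h3 x hx] at hPx
      exact sub_eq_zero.mp (pow_eq_zero_iff two_ne_zero |>.mp hPx)
  · rintro x ⟨hxl, hxr⟩
    have hεx := mul_neg_of_pos_of_neg hε0 hxr
    constructor
    · rw [h2 x hxl.le hxr]
      linarith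
    · rw [abs_of_neg (by linarith)]
      linarith
end
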